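/- arXiv:0909.1091 — 2 statements merged into one kernel-verified Lean document; each statement's English description precedes it below -/
import Mathlib

section
/- If a square S in the plane has diagonal of length d and contains an open subsquare that is empty of points of a set ω, with the subsquare having diagonal d/2, then S contains an axis-aligned-free empty square of area d²/16. Consequently, if a disc B_R of radius R contains two points x, y of ω at Euclidean distance at least aR/6 whose Voronoi cells are adjacent, then B_{2R} contains an open square of area (aR/6)²/4 containing no point of ω. -/
open Set Metric

local notation "E" => EuclideanSpace ℝ (Fin 2)

/-- `S` is an open square of side length `s` in the plane (in any orientation). -/
def IsOpenSquare (S : Set E) (s : ℝ) : Prop :=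
  ∃ f : E ≃ᵃⁱ[ℝ] E, S = f '' {p | p 0 ∈ Set.Ioo 0 s ∧ p 1 ∈ Set.Ioo 0 s}

/-- The Voronoi cells of `x` and `y` with respect to `ω` are adjacent: some point is
equidistant from `x` and `y` and strictly closer to them than to any other point of `ω`. -/
def VoronoiAdjacent (ω : Set E) (x y : E) : Prop :=
  x ∈ ω ∧ y ∈ ω ∧ x ≠ y ∧
    ∃ z : E, dist z x = dist z y ∧ ∀ w ∈ ω, w ≠ x → w ≠ y → dist z x < dist z w

lemma square_mono (f : E ≃ᵃⁱ[ℝ] E) {s t : ℝ} (h : s ≤ t) :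
    f '' {p | p 0 ∈ Set.Ioo 0 s ∧ p 1 ∈ Set.Ioo 0 s} ⊆
      f '' {p | p 0 ∈ Set.Ioo 0 t ∧ p 1 ∈ Set.Ioo 0 t} := by
  apply Set.image_mono
  rintro p ⟨h0, h1⟩
  exact ⟨⟨h0.1, h0.2.trans_le h⟩, ⟨h1.1, h1.2.trans_le h⟩⟩

lemma exists_frame (c0 c1 α β ε : ℝ) (h : α ^ 2 + β ^ 2 = 1) (hε : ε ^ 2 = 1) :
    ∃ f : E ≃ᵃⁱ[ℝ] E, ∀ p : E, (f p) 0 = c0 + α * p 0 - ε * β * p 1 ∧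
      (f p) 1 = c1 + β * p 0 + ε * α * p 1 := by
  let l : E →ₗ[ℝ] E :=
    { toFun := fun p => !₂[α * p 0 - ε * β * p 1, β * p 0 + ε * α * p 1]
      map_add' := by
        intro p q
        ext i
        fin_cases i <;> simp <;> ring
      map_smul' := by
        intro k p
        ext i
        fin_cases i <;> simp <;> ring }
  let li : E →ₗᵢ[ℝ] E :=
    { l with
      norm_map' := by
        intro p
        rw [EuclideanSpace.norm_eq, EuclideanSpace.norm_eq]
        congr 1
        simp only [Fin.sum_univ_two, Real.norm_eq_abs, sq_abs]
        simp only [l, LinearMap.coe_mk, AddHom.coe_mk]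
        simp
        linear_combination (p 0 ^ 2 + ε ^ 2 * p 1 ^ 2) * h + p 1 ^ 2 * hε }
  let le := li.toLinearIsometryEquiv rfl
  refine ⟨le.toAffineIsometryEquiv.trans (AffineIsometryEquiv.constVAdd ℝ E (!₂[c0, c1] : E)), ?_⟩
  intro p
  have : le p = !₂[α * p 0 - ε * β * p 1, β * p 0 + ε * α * p 1] := rfl
  constructor <;> simp [this] <;> ring

lemma dist_sq_two (p q : E) : dist p q ^ 2 = (p 0 - q 0) ^ 2 + (p 1 - q 1) ^ 2 := by
  rw [EuclideanSpace.dist_eq, Real.sq_sqrt (by positivity)]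
  simp [Fin.sum_univ_two, Real.dist_eq, sq_abs]

/-- The real-number core: a square of side `r` next to the chord lies in the disc. -/
lemma core (r h : ℝ) (hr : 0 < r) (hh : 0 ≤ h) : ∃ c : ℝ, ∀ u v : ℝ,
    -(r / 2) < u → u < r / 2 → c < v → v < c + r →
      u ^ 2 + v ^ 2 - 2 * h * v < r ^ 2 ∧ u ^ 2 + v ^ 2 ≤ 5 / 4 * r ^ 2 := by
  rcases le_total h (r / 2) with hc | hc
  · refine ⟨-(r / 2), fun u v h1 h2 h3 h4 => ?_⟩
    have hu : u ^ 2 < r ^ 2 / 4 := by nlinarith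
    have hv : v ^ 2 < r ^ 2 / 4 := by nlinarith
    constructor <;> nlinarith
  · refine ⟨0, fun u v h1 h2 h3 h4 => ?_⟩
    have hu : u ^ 2 < r ^ 2 / 4 := by nlinarith
    have hv : v ^ 2 < r * v := by nlinarith
    constructor <;> nlinarith

lemma part_two (ω : Set E) (R s : ℝ) (hR : 0 < R) (hs : 0 < s) (x y : E)
    (hx : x ∈ closedBall (0 : E) R) (hy : y ∈ closedBall (0 : E) R)
    (hd : 2 * s ≤ dist x y) (hV : VoronoiAdjacent ω x y) :
    ∃ S : Set E, IsOpenSquare S s ∧ S ⊆ ball (0 : E) (2 * R) ∧ S ∩ ω = ∅ := by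
  obtain ⟨-, -, -, z, hz, hw⟩ := hV
  obtain ⟨r, hr⟩ : ∃ r, r = dist x y / 2 := ⟨_, rfl⟩
  have hr0 : 0 < r := by linarith
  have hsr : s ≤ r := by linarith
  have hxR : x 0 ^ 2 + x 1 ^ 2 ≤ R ^ 2 := by
    have h1 := dist_sq_two x 0
    have h2 : dist x 0 ≤ R := hx
    have h3 := pow_le_pow_left₀ dist_nonneg h2 2
    simp only [PiLp.zero_apply, sub_zero] at h1
    linarith
  have hyR : y 0 ^ 2 + y 1 ^ 2 ≤ R ^ 2 := by
    have h1 := dist_sq_two y 0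
    have h2 : dist y 0 ≤ R := hy
    have h3 := pow_le_pow_left₀ dist_nonneg h2 2
    simp only [PiLp.zero_apply, sub_zero] at h1
    linarith
  have hxy : (x 0 - y 0) ^ 2 + (x 1 - y 1) ^ 2 = 4 * r ^ 2 := by
    rw [← dist_sq_two, hr]; ring
  have hzz : (z 0 - x 0) ^ 2 + (z 1 - x 1) ^ 2 = (z 0 - y 0) ^ 2 + (z 1 - y 1) ^ 2 := by
    rw [← dist_sq_two, ← dist_sq_two, hz]
  have hzx := dist_sq_two z x
  obtain ⟨α, hα⟩ : ∃ α, α = (y 0 - x 0) / (2 * r) := ⟨_, rfl⟩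
  obtain ⟨β, hβ⟩ : ∃ β, β = (y 1 - x 1) / (2 * r) := ⟨_, rfl⟩
  obtain ⟨m0, hm0⟩ : ∃ m, m = (x 0 + y 0) / 2 := ⟨_, rfl⟩
  obtain ⟨m1, hm1⟩ : ∃ m, m = (x 1 + y 1) / 2 := ⟨_, rfl⟩
  have hα' : α * (2 * r) = y 0 - x 0 := by rw [hα]; field_simp
  have hβ' : β * (2 * r) = y 1 - x 1 := by rw [hβ]; field_simp
  have hx0 : x 0 = m0 - r * α := by linarith
  have hx1 : x 1 = m1 - r * β := by linarith
  have hy0 : y 0 = m0 + r * α := by linarith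
  have hy1 : y 1 = m1 + r * β := by linarith
  clear hα hβ hm0 hm1 hα' hβ'
  rw [hx0, hx1] at hxR hxy hzz hzx
  rw [hy0, hy1] at hyR hxy hzz
  have hab : α ^ 2 + β ^ 2 = 1 := by
    have : 4 * r ^ 2 * (α ^ 2 + β ^ 2 - 1) = 0 := by linear_combination hxy
    have h4 : 4 * r ^ 2 ≠ 0 := by positivity
    have := (mul_eq_zero.mp this).resolve_left h4
    linarith
  have hmR : m0 ^ 2 + m1 ^ 2 + r ^ 2 ≤ R ^ 2 := by
    have : m0 ^ 2 + m1 ^ 2 + r ^ 2 * (α ^ 2 + β ^ 2) ≤ R ^ 2 := by linarith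
    rw [hab] at this; linarith
  have horth : (z 0 - m0) * α + (z 1 - m1) * β = 0 := by
    have : r * ((z 0 - m0) * α + (z 1 - m1) * β) = 0 := by linear_combination hzz / 4
    exact (mul_eq_zero.mp this).resolve_left hr0.ne'
  obtain ⟨ε, h, hε, hh, hhe⟩ : ∃ ε h : ℝ, ε ^ 2 = 1 ∧ 0 ≤ h ∧
      ε * h = -(z 0 - m0) * β + (z 1 - m1) * α := by
    rcases le_total 0 (-(z 0 - m0) * β + (z 1 - m1) * α) with h | h
    · exact ⟨1, _, by norm_num, h, by ring⟩
    · exact ⟨-1, -(-(z 0 - m0) * β + (z 1 - m1) * α), by norm_num, by linarith, by ring⟩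
  have hz0 : z 0 = m0 - ε * h * β := by
    rw [hhe]; linear_combination α * horth - (z 0 - m0) * hab
  have hz1 : z 1 = m1 + ε * h * α := by
    rw [hhe]; linear_combination β * horth - (z 1 - m1) * hab
  have hρ : dist z x ^ 2 = r ^ 2 + h ^ 2 := by
    rw [hzx, hz0, hz1]
    linear_combination (ε ^ 2 * h ^ 2 + r ^ 2) * hab + h ^ 2 * hε
  obtain ⟨c, hc⟩ := core r h hr0 hh
  obtain ⟨f, hf⟩ := exists_frame (m0 - r / 2 * α - ε * β * c) (m1 - r / 2 * β + ε * α * c)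
    α β ε hab hε
  have key : ∀ q ∈ f '' {p | p 0 ∈ Set.Ioo 0 s ∧ p 1 ∈ Set.Ioo 0 s},
      ∃ u v : ℝ, q 0 = m0 + α * u - ε * β * v ∧ q 1 = m1 + β * u + ε * α * v ∧
      u ^ 2 + v ^ 2 - 2 * h * v < r ^ 2 ∧ u ^ 2 + v ^ 2 ≤ 5 / 4 * r ^ 2 := by
    rintro q ⟨p, ⟨⟨h1, h2⟩, h3, h4⟩, rfl⟩
    refine ⟨p 0 - r / 2, c + p 1, ?_, ?_, hc _ _ (by linarith) (by linarith) (by linarith)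
      (by linarith)⟩
    · rw [(hf p).1]; ring
    · rw [(hf p).2]; ring
  refine ⟨_, ⟨f, rfl⟩, ?_, ?_⟩
  · intro q hq
    obtain ⟨u, v, hq0, hq1, -, h2⟩ := key q hq
    rw [mem_ball]
    apply lt_of_pow_lt_pow_left₀ 2 (by positivity)
    rw [dist_sq_two, hq0, hq1]
    simp only [PiLp.zero_apply, sub_zero]
    obtain ⟨w0, hw0⟩ : ∃ w, w = α * u - ε * β * v := ⟨_, rfl⟩
    obtain ⟨w1, hw1⟩ : ∃ w, w = β * u + ε * α * v := ⟨_, rfl⟩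
    have hww : w0 ^ 2 + w1 ^ 2 = u ^ 2 + v ^ 2 := by
      rw [hw0, hw1]; linear_combination (u ^ 2 + ε ^ 2 * v ^ 2) * hab + v ^ 2 * hε
    have e0 : m0 + α * u - ε * β * v = m0 + w0 := by rw [hw0]; ring
    have e1 : m1 + β * u + ε * α * v = m1 + w1 := by rw [hw1]; ring
    rw [e0, e1]
    have hR2 : 0 < R ^ 2 := by positivity
    have g0 : (m0 + w0) ^ 2 ≤ 9 / 4 * m0 ^ 2 + 9 / 5 * w0 ^ 2 := by
      linarith [sq_nonneg (5 * m0 - 4 * w0)]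
    have g1 : (m1 + w1) ^ 2 ≤ 9 / 4 * m1 ^ 2 + 9 / 5 * w1 ^ 2 := by
      linarith [sq_nonneg (5 * m1 - 4 * w1)]
    have e2 : (2 * R) ^ 2 = 4 * R ^ 2 := by ring
    rw [e2]
    linarith
  · rw [Set.eq_empty_iff_forall_notMem]
    rintro q ⟨hq, hqω⟩
    obtain ⟨u, v, hq0, hq1, h1, -⟩ := key q hq
    have hlt : dist z q < dist z x := by
      apply lt_of_pow_lt_pow_left₀ 2 dist_nonneg
      rw [hρ, dist_sq_two, hq0, hq1, hz0, hz1]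
      have : (m0 - ε * h * β - (m0 + α * u - ε * β * v)) ^ 2 +
          (m1 + ε * h * α - (m1 + β * u + ε * α * v)) ^ 2 = u ^ 2 + (v - h) ^ 2 := by
        linear_combination (u ^ 2 + ε ^ 2 * (v - h) ^ 2) * hab + (v - h) ^ 2 * hε
      rw [this]; linarith
    have hqx : q ≠ x := by rintro rfl; exact lt_irrefl _ hlt
    have hqy : q ≠ y := by rintro rfl; rw [hz] at hlt; exact lt_irrefl _ hlt
    exact lt_asymm hlt (hw q hqω hqx hqy)

/-- (1) A square with diagonal `d` containing an empty open subsquare of diagonal `d/2`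
contains an empty square of area `d²/16`.  (2) Consequently, if the disc `B_R` contains two
points of `ω` at distance at least `aR/6` with adjacent Voronoi cells, then `B_{2R}`
contains an open square of area `(aR/6)²/4` with no point of `ω`. -/
theorem stmt_3 :
    (∀ (ω S : Set E) (d : ℝ), 0 < d →
      IsOpenSquare S (d / Real.sqrt 2) →
      (∃ S' ⊆ S, IsOpenSquare S' (d / 2 / Real.sqrt 2) ∧ S' ∩ ω = ∅) →
      ∃ S'' ⊆ S, IsOpenSquare S'' (Real.sqrt (d ^ 2 / 16)) ∧ S'' ∩ ω = ∅) ∧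
    (∀ (ω : Set E), (∀ (p : E) (r : ℝ), (ω ∩ closedBall p r).Finite) →
      ∀ (a R : ℝ), 0 < a → 0 < R →
      (∃ x ∈ ω ∩ closedBall (0 : E) R, ∃ y ∈ ω ∩ closedBall (0 : E) R,
        a * R / 6 ≤ dist x y ∧ VoronoiAdjacent ω x y) →
      ∃ S : Set E, IsOpenSquare S (Real.sqrt ((a * R / 6) ^ 2 / 4)) ∧
        S ⊆ ball (0 : E) (2 * R) ∧ S ∩ ω = ∅) := by
  refine ⟨?_, ?_⟩
  · rintro ω S d hd - ⟨S', hS', ⟨f, rfl⟩, hempty⟩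
    have h2 : Real.sqrt (d ^ 2 / 16) ≤ d / 2 / Real.sqrt 2 := by
      have e : d ^ 2 / 16 = (d / 4) ^ 2 := by ring
      rw [e, Real.sqrt_sq (by positivity), le_div_iff₀ (by positivity)]
      have : Real.sqrt 2 ≤ 2 := by
        rw [Real.sqrt_le_left (by norm_num)]; norm_num
      nlinarith
    have hm := square_mono f h2
    refine ⟨_, hm.trans hS', ⟨f, rfl⟩, ?_⟩
    exact Set.subset_eq_empty (Set.inter_subset_inter_left ω hm) hempty
  · rintro ω - a R ha hR ⟨x, hx, y, hy, hd, hV⟩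
    have e : (a * R / 6) ^ 2 / 4 = (a * R / 12) ^ 2 := by ring
    rw [e, Real.sqrt_sq (by positivity)]
    exact part_two ω R _ hR (by positivity) x y hx.2 hy.2 (by linarith) hV
end

section
/- Let ω be a homogeneous Poisson point process on ℝ² with intensity 1, and let G be the Voronoi (Delaunay) adjacency graph on ω. Then for every a > 0, the probability that the disc B_R(o) of radius R around the origin contains two points x, y ∈ ω with adjacent Voronoi cells and Euclidean distance at least aR/6 tends to 0 as R → ∞. In particular, the Poisson–Voronoi map has the regular decay property. -/
open Set Metric MeasureTheory Filter

local notation "E" => EuclideanSpace ℝ (Fin 2)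

/-- `X` is a homogeneous Poisson point process of intensity `1` on the plane under `P`:
counts in a Borel set of finite volume are Poisson with mean the volume, and counts in
disjoint Borel sets are independent. -/
def IsPoissonPP {Ω : Type*} [MeasurableSpace Ω] (P : Measure Ω) (X : Ω → Set E) : Prop :=
  (∀ A : Set E, MeasurableSet A → volume A < ⊤ → ∀ k : ℕ,
      P {ω | (X ω ∩ A).Finite ∧ (X ω ∩ A).ncard = k} =
        ENNReal.ofReal (Real.exp (-(volume A).toReal) * (volume A).toReal ^ k /
          Nat.factorial k)) ∧
  (∀ A B : Set E, MeasurableSet A → MeasurableSet B → Disjoint A B → ∀ j k : ℕ,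
      P ({ω | (X ω ∩ A).Finite ∧ (X ω ∩ A).ncard = j} ∩
          {ω | (X ω ∩ B).Finite ∧ (X ω ∩ B).ncard = k}) =
        P {ω | (X ω ∩ A).Finite ∧ (X ω ∩ A).ncard = j} *
          P {ω | (X ω ∩ B).Finite ∧ (X ω ∩ B).ncard = k})

/-- The event that `B_R(o)` contains the endpoints of a Voronoi edge of Euclidean
length at least `t`. -/
def badEvent {Ω : Type*} (X : Ω → Set E) (R t : ℝ) : Set Ω :=
  {ω | ∃ x ∈ X ω ∩ closedBall (0 : E) R, ∃ y ∈ X ω ∩ closedBall (0 : E) R,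
    t ≤ dist x y ∧ VoronoiAdjacent (X ω) x y}

/-- A long Voronoi edge forces an empty ball of comparable radius near the origin. -/
lemma exists_empty_ball (W : Set E) (R t : ℝ) (ht : 0 < t) (x y : E)
    (hx : x ∈ closedBall (0 : E) R) (hy : y ∈ closedBall (0 : E) R)
    (hxy : t ≤ dist x y) (h : VoronoiAdjacent W x y) :
    ∃ z ∈ closedBall (0 : E) (2 * R), W ∩ ball z (t / 2) = ∅ := by
  obtain ⟨-, -, -, z, hz, hw⟩ := h
  have hρ : t / 2 ≤ dist z x := by
    have := dist_triangle_left x y z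
    linarith
  have hx' : ‖x‖ ≤ R := by simpa using hx
  have hy' : ‖y‖ ≤ R := by simpa using hy
  have htR : t / 2 ≤ R := by
    have : dist x y ≤ ‖x‖ + ‖y‖ := by rw [dist_eq_norm]; exact norm_sub_le x y
    linarith
  have hρ0 : 0 < dist z x := by linarith
  set l : ℝ := t / 2 / dist z x with hl
  have hl0 : 0 ≤ l := by positivity
  have hl1 : l ≤ 1 := by rw [hl, div_le_one hρ0]; exact hρ
  have hlm : l * dist z x = t / 2 := by rw [hl]; field_simp
  have d1 : dist (AffineMap.lineMap x z l) x = t / 2 := by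
    rw [dist_lineMap_left, dist_comm x z, Real.norm_of_nonneg hl0, hlm]
  have d2 : dist (AffineMap.lineMap x z l) z = dist z x - t / 2 := by
    rw [dist_lineMap_right, dist_comm x z, Real.norm_of_nonneg (by linarith), ← hlm]
    ring
  refine ⟨AffineMap.lineMap x z l, ?_, ?_⟩
  · rw [mem_closedBall]
    have := dist_triangle (AffineMap.lineMap x z l) x (0 : E)
    rw [d1, dist_zero_right x] at this
    linarith
  · rw [Set.eq_empty_iff_forall_notMem]
    rintro w ⟨hwW, hwb⟩
    rw [mem_ball] at hwb
    have hlt : dist z w < dist z x := by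
      have := dist_triangle w (AffineMap.lineMap x z l) z
      rw [d2] at this
      rw [dist_comm z w]
      linarith
    by_cases h1 : w = x
    · subst h1; exact lt_irrefl _ hlt
    by_cases h2 : w = y
    · subst h2; rw [hz] at hlt; exact lt_irrefl _ hlt
    exact lt_asymm hlt (hw w hwW h1 h2)

lemma prob_empty {Ω : Type*} [MeasurableSpace Ω] (P : Measure Ω)
    (X : Ω → Set E) (hX : IsPoissonPP P X) (c : E) (s : ℝ) (hs : 0 ≤ s) :
    P {ω | X ω ∩ ball c s = ∅} = ENNReal.ofReal (Real.exp (-(s ^ 2 * Real.pi))) := by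
  have h := hX.1 (ball c s) measurableSet_ball measure_ball_lt_top 0
  have e : {ω | (X ω ∩ ball c s).Finite ∧ (X ω ∩ ball c s).ncard = 0}
      = {ω | X ω ∩ ball c s = ∅} := by
    ext ω
    constructor
    · rintro ⟨h1, h2⟩
      exact (Set.ncard_eq_zero h1).1 h2
    · intro h1
      have h1 : X ω ∩ ball c s = ∅ := h1
      simp [h1]
  rw [e] at h
  rw [h, EuclideanSpace.volume_ball_fin_two]
  have : (ENNReal.ofReal s ^ 2 * ENNReal.ofReal Real.pi).toReal = s ^ 2 * Real.pi := by
    simp [ENNReal.toReal_ofReal hs, Real.pi_pos.le]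
  rw [this]
  simp

lemma first_part {Ω : Type*} [MeasurableSpace Ω] (P : Measure Ω)
    (X : Ω → Set E) (hX : IsPoissonPP P X) (a : ℝ) (ha : 0 < a) :
    Tendsto (fun R : ℝ => P (badEvent X R (a * R / 6))) atTop (nhds 0) := by
  obtain ⟨T, -, hTf, hT⟩ := (isCompact_closedBall (0 : E) 2).finite_cover_balls
    (e := a / 24) (by positivity)
  have hlim : Tendsto (fun R : ℝ => ∑ c ∈ hTf.toFinset,
      ENNReal.ofReal (Real.exp (-((a * R / 24) ^ 2 * Real.pi)))) atTop (nhds 0) := by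
    have h0 : Tendsto (fun R : ℝ =>
        ENNReal.ofReal (Real.exp (-((a * R / 24) ^ 2 * Real.pi)))) atTop (nhds 0) := by
      rw [← ENNReal.ofReal_zero]
      refine (ENNReal.continuous_ofReal.tendsto 0).comp ?_
      refine Real.tendsto_exp_neg_atTop_nhds_zero.comp ?_
      refine Tendsto.atTop_mul_const Real.pi_pos ?_
      refine (tendsto_pow_atTop two_ne_zero).comp ?_
      exact (tendsto_id.const_mul_atTop ha).atTop_div_const (by norm_num)
    simpa using tendsto_finsetSum hTf.toFinset (fun _ _ => h0)
  refine tendsto_of_tendsto_of_tendsto_of_le_of_le' tendsto_const_nhds hlim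
    (Eventually.of_forall fun _ => zero_le) ?_
  filter_upwards [eventually_gt_atTop 0] with R hR
  have hsub : badEvent X R (a * R / 6) ⊆
      ⋃ c ∈ hTf.toFinset, {ω | X ω ∩ ball (R • c) (a * R / 24) = ∅} := by
    rintro ω ⟨x, ⟨-, hx⟩, y, ⟨-, hy⟩, hxy, hadj⟩
    obtain ⟨z, hz, hemp⟩ := exists_empty_ball (X ω) R (a * R / 6) (by positivity) x y
      hx hy hxy hadj
    have hz2 : R⁻¹ • z ∈ closedBall (0 : E) 2 := by
      rw [mem_closedBall, dist_zero_right] at hz ⊢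
      rw [norm_smul, norm_inv, Real.norm_of_nonneg hR.le, inv_mul_le_iff₀ hR]
      linarith
    have := hT hz2
    simp only [mem_iUnion, exists_prop] at this
    obtain ⟨c, hc, hzc⟩ := this
    simp only [mem_iUnion, exists_prop, Set.Finite.mem_toFinset, mem_ofPred_eq]
    refine ⟨c, hc, ?_⟩
    have hd : dist z (R • c) < a * R / 24 := by
      have e : z = R • (R⁻¹ • z) := by rw [smul_inv_smul₀ hR.ne']
      rw [e, dist_smul₀, Real.norm_of_nonneg hR.le]
      rw [mem_ball] at hzc
      calc R * dist (R⁻¹ • z) c < R * (a / 24) := mul_lt_mul_of_pos_left hzc hR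
        _ = _ := by ring
    refine Set.subset_empty_iff.1 (hemp ▸ ?_)
    refine inter_subset_inter_right _ (ball_subset_ball' ?_)
    rw [dist_comm]
    linarith
  calc P (badEvent X R (a * R / 6)) ≤ _ := measure_mono hsub
    _ ≤ ∑ c ∈ hTf.toFinset, P {ω | X ω ∩ ball (R • c) (a * R / 24) = ∅} :=
      measure_biUnion_finset_le _ _
    _ ≤ _ := by
      refine Finset.sum_le_sum fun c _ => ?_
      rw [prob_empty P X hX _ _ (by positivity)]

/-- For a Poisson process of intensity 1, for every `a > 0` the probability that `B_R(o)`
contains two points with adjacent Voronoi cells at distance at least `aR/6` tends to `0`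
as `R → ∞`; in particular the Poisson–Voronoi map has the regular decay property. -/
theorem stmt_4 {Ω : Type*} [MeasurableSpace Ω] (P : Measure Ω) [IsProbabilityMeasure P]
    (X : Ω → Set E) (hX : IsPoissonPP P X) :
    (∀ a : ℝ, 0 < a →
      Tendsto (fun R : ℝ => P (badEvent X R (a * R / 6))) atTop (nhds 0)) ∧
    (∃ aa : ℝ → ℝ, (∀ r, 0 < aa r) ∧ Tendsto aa atTop (nhds 0) ∧
      ∀ r R : ℝ, 0 < r → r ≤ R →
        P (badEvent X R (aa r * R / 6)) < ENNReal.ofReal (aa r)) := by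
  have H := first_part P X hX
  refine ⟨H, ?_⟩
  let S : ℝ → Set ℝ := fun r =>
    {a | 0 < a ∧ ∀ R, r ≤ R → P (badEvent X R (a * R / 6)) < ENNReal.ofReal a}
  have h2 : ∀ r, (2 : ℝ) ∈ S r := fun r => ⟨by norm_num, fun R _ =>
    lt_of_le_of_lt prob_le_one (by norm_num)⟩
  have hb : ∀ r, BddBelow (S r) := fun r => ⟨0, fun a ha => ha.1.le⟩
  have hex : ∀ r, ∃ a ∈ S r, a < sInf (S r) + Real.exp (-r) := fun r =>
    exists_lt_of_csInf_lt ⟨2, h2 r⟩ (by linarith [Real.exp_pos (-r)])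
  choose aa haa hlt using hex
  refine ⟨aa, fun r => (haa r).1, ?_, fun r R _ hR => (haa r).2 R hR⟩
  rw [Metric.tendsto_nhds]
  intro ε hε
  have e1 : ∀ᶠ r in atTop, P (badEvent X r (ε / 2 * r / 6)) < ENNReal.ofReal (ε / 2) :=
    (H (ε / 2) (by positivity)).eventually_lt_const (by simpa using hε)
  have e2 : ∀ᶠ r : ℝ in atTop, Real.exp (-r) < ε / 2 :=
    Real.tendsto_exp_neg_atTop_nhds_zero.eventually_lt_const (by positivity)
  obtain ⟨R0, hR0⟩ := eventually_atTop.1 e1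
  filter_upwards [e2, eventually_ge_atTop R0] with r hr1 hr2
  have hS : ε / 2 ∈ S r := ⟨by positivity, fun R hR => hR0 R (hr2.trans hR)⟩
  have := csInf_le (hb r) hS
  rw [dist_zero_right, Real.norm_of_nonneg (haa r).1.le]
  linarith [hlt r]
end
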